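/- Consider the CLTRP with zero-processing times and only deadlines (τ(a) = 0 and r(a) = 0 for all a ∈ A). Every optimal solution (t, x) (one minimizing the sum of completion times C_sum among feasible solutions) is order-preserving: for any two clients a, a' both in L or both in R with |s(a)| < |s(a')| one has t(a) < t(a'). -/

import Mathlib

open scoped BigOperators

/-- An instance of the collaborative line TSP/TRP: a finite set of `n` clients,
a client speed `v > 0`, and for each client a start position `s`, release date
`r ≥ 0`, deadline `d ∈ [0, ∞]` and processing time `tau ≥ 0`. -/
structure CInstance (n : ℕ) where
  v : ℝ
  s : Fin n → ℝ
  r : Fin n → ℝ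
  d : Fin n → EReal
  tau : Fin n → ℝ
  hv : 0 < v
  hr : ∀ a, 0 ≤ r a
  hd : ∀ a, (0 : EReal) ≤ d a
  htau : ∀ a, 0 ≤ tau a

/-- A solution: a serving order `σ` (the `i`-th rendezvous, `i = 0, …, n-1`
in zero-based counting, serves client `σ i`), a rendezvous time `t a` and a
rendezvous position `x a` for every client `a`, and a final time `tEnd` at
which the server is back at the origin. -/
structure CSolution (n : ℕ) where
  σ : Equiv.Perm (Fin n)
  t : Fin n → ℝ
  x : Fin n → ℝ
  tEnd : ℝ

namespace CLTSP

variable {n : ℕ}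

/-- Position `x_i` of the `i`-th server stop, `i = 0, …, n+1`; `x_0 = x_{n+1} = 0`. -/
def pos (sol : CSolution n) (i : ℕ) : ℝ :=
  if h : 1 ≤ i ∧ i ≤ n then sol.x (sol.σ ⟨i - 1, by omega⟩) else 0

/-- Time `t_i` of the `i`-th server stop, `i = 0, …, n+1`; `t_0 = 0`, `t_{n+1} = tEnd`. -/
def time (sol : CSolution n) (i : ℕ) : ℝ :=
  if h : 1 ≤ i ∧ i ≤ n then sol.t (sol.σ ⟨i - 1, by omega⟩)
  else if i = 0 then 0 else sol.tEnd

/-- Completion time `c_i` of the `i`-th rendezvous: `c_0 = 0`,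
`c_i = t_i + τ(σ_i)` for `1 ≤ i ≤ n`, and `c_{n+1} = tEnd`. -/
def comp (I : CInstance n) (sol : CSolution n) (i : ℕ) : ℝ :=
  if h : 1 ≤ i ∧ i ≤ n then
    sol.t (sol.σ ⟨i - 1, by omega⟩) + I.tau (sol.σ ⟨i - 1, by omega⟩)
  else if i = 0 then 0 else sol.tEnd

/-- Feasibility: every rendezvous (including the final return to the origin) is
reachable by the server, every rendezvous is reachable by the corresponding
client, and every client is served within its time window. -/
def Feasible (I : CInstance n) (sol : CSolution n) : Prop :=
  (∀ i : ℕ, 1 ≤ i → i ≤ n + 1 →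
      comp I sol (i - 1) + |pos sol i - pos sol (i - 1)| ≤ time sol i) ∧
  (∀ a, I.r a + |sol.x a - I.s a| / I.v ≤ sol.t a) ∧
  (∀ a, I.r a ≤ sol.t a ∧ (sol.t a : EReal) ≤ I.d a)

/-- The makespan `C_max = c_{n+1}`. -/
def makespan (sol : CSolution n) : ℝ := sol.tEnd

/-- The sum of completion times `C_sum = ∑_{i=1}^n c_i = ∑_a (t a + τ a)`. -/
def csum (I : CInstance n) (sol : CSolution n) : ℝ :=
  ∑ a : Fin n, (sol.t a + I.tau a)

/-- An optimal CLTSP solution: feasible with minimum makespan. -/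
def OptimalTSP (I : CInstance n) (sol : CSolution n) : Prop :=
  Feasible I sol ∧ ∀ sol' : CSolution n, Feasible I sol' → makespan sol ≤ makespan sol'

/-- An optimal CLTRP solution: feasible with minimum sum of completion times. -/
def OptimalTRP (I : CInstance n) (sol : CSolution n) : Prop :=
  Feasible I sol ∧ ∀ sol' : CSolution n, Feasible I sol' → csum I sol ≤ csum I sol'

/-- Order-preserving: for clients `a, a'` both in `L = {a : s a ≤ 0}` or both in
`R = {a : 0 < s a}` with `|s a| < |s a'|` we have `t a < t a'`. -/
def OrderPreserving (I : CInstance n) (sol : CSolution n) : Prop :=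
  ∀ a a' : Fin n,
    ((I.s a ≤ 0 ∧ I.s a' ≤ 0) ∨ (0 < I.s a ∧ 0 < I.s a')) →
    |I.s a| < |I.s a'| → sol.t a < sol.t a'

/-- Wait-free server: `t_i = c_{i-1} + |x_i - x_{i-1}|` for all `1 ≤ i ≤ n+1`. -/
def WaitFree (I : CInstance n) (sol : CSolution n) : Prop :=
  ∀ i : ℕ, 1 ≤ i → i ≤ n + 1 →
    time sol i = comp I sol (i - 1) + |pos sol i - pos sol (i - 1)|

/-- Colliding clients: each client `a = σ_i` satisfies
`t a = max (r a + |s a - x a| / v) (c_{i-1})`. -/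
def Colliding (I : CInstance n) (sol : CSolution n) : Prop :=
  ∀ a : Fin n,
    sol.t a = max (I.r a + |I.s a - sol.x a| / I.v)
      (comp I sol ((sol.σ.symm a : ℕ)))

end CLTSP

namespace CLTSP

variable {n : ℕ}

theorem comp_eq_time (I : CInstance n) (htau : ∀ a, I.tau a = 0) (sol : CSolution n) (i : ℕ) :
    comp I sol i = time sol i := by
  simp [comp, time, htau]

@[simp]
theorem pos_zero (sol : CSolution n) : pos sol 0 = 0 := by simp [pos]

@[simp]
theorem time_zero (sol : CSolution n) : time sol 0 = 0 := by simp [time]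

theorem pos_succ (sol : CSolution n) {i : ℕ} (hi : i < n) :
    pos sol (i + 1) = sol.x (sol.σ ⟨i, hi⟩) := by
  simp [pos, Nat.succ_le_of_lt hi]

theorem time_succ (sol : CSolution n) {i : ℕ} (hi : i < n) :
    time sol (i + 1) = sol.t (sol.σ ⟨i, hi⟩) := by
  simp [time, Nat.succ_le_of_lt hi]

theorem pos_symm (sol : CSolution n) (a : Fin n) : pos sol (sol.σ.symm a + 1) = sol.x a := by
  simp [pos_succ sol (sol.σ.symm a).isLt]

theorem time_symm (sol : CSolution n) (a : Fin n) : time sol (sol.σ.symm a + 1) = sol.t a := by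
  simp [time_succ sol (sol.σ.symm a).isLt]

/-- The server travels with speed at most one between any two stops. -/
theorem Feasible.abs_pos_sub_le {I : CInstance n} (htau : ∀ a, I.tau a = 0) {sol : CSolution n}
    (hf : Feasible I sol) {i j : ℕ} (hij : i ≤ j) (hj : j ≤ n + 1) :
    |pos sol j - pos sol i| ≤ time sol j - time sol i := by
  induction j, hij using Nat.le_induction with
  | base => simp
  | succ j hij ih =>
    have hstep := hf.1 (j + 1) (by omega) hj
    rw [comp_eq_time I htau, Nat.add_sub_cancel] at hstep
    have htri := abs_sub_le (pos sol (j + 1)) (pos sol j) (pos sol i)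
    linarith [ih (by omega)]

theorem Feasible.abs_x_le {I : CInstance n} (htau : ∀ a, I.tau a = 0) {sol : CSolution n}
    (hf : Feasible I sol) (a : Fin n) : |sol.x a| ≤ sol.t a := by
  have h := hf.abs_pos_sub_le htau (i := 0) (j := sol.σ.symm a + 1) (by omega)
    (by have := (sol.σ.symm a).isLt; omega)
  simpa [pos_symm, time_symm] using h

theorem Feasible.abs_x_sub_le {I : CInstance n} (htau : ∀ a, I.tau a = 0) {sol : CSolution n}
    (hf : Feasible I sol) (a b : Fin n) : |sol.x a - sol.x b| ≤ |sol.t a - sol.t b| := by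
  have ha := (sol.σ.symm a).isLt
  have hb := (sol.σ.symm b).isLt
  rw [← pos_symm, ← pos_symm, ← time_symm, ← time_symm]
  rcases le_total (sol.σ.symm a : ℕ) (sol.σ.symm b) with h | h
  · rw [abs_sub_comm, abs_sub_comm (time _ _)]
    exact (hf.abs_pos_sub_le htau (by omega) (by omega)).trans (le_abs_self _)
  · exact (hf.abs_pos_sub_le htau (by omega) (by omega)).trans (le_abs_self _)

/-- Points in space-time are interpolated by a 1-Lipschitz path as soon as they pairwise
respect the unit speed limit. -/
theorem exists_lipschitz_path {ι : Type*} (t x : ι → ℝ)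
    (h : ∀ i j, |x i - x j| ≤ |t i - t j|) :
    ∃ p : ℝ → ℝ, LipschitzWith 1 p ∧ ∀ i, p (t i) = x i := by
  have hfac : Function.FactorsThrough x t := fun i j hij => by
    have := h i j
    rwa [hij, sub_self, abs_zero, abs_nonpos_iff, sub_eq_zero] at this
  have hlip : LipschitzOnWith 1 (Function.extend t x 0) (Set.range t) := by
    refine LipschitzOnWith.of_dist_le_mul ?_
    rintro _ ⟨i, rfl⟩ _ ⟨j, rfl⟩
    simpa [hfac.extend_apply, Real.dist_eq] using h i j
  obtain ⟨p, hp, heq⟩ := hlip.extend_real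
  exact ⟨p, hp, fun i => by rw [← heq ⟨i, rfl⟩, hfac.extend_apply]⟩

/-- The path of the server in a feasible solution. -/
theorem Feasible.exists_path {I : CInstance n} (htau : ∀ a, I.tau a = 0) {sol : CSolution n}
    (hf : Feasible I sol) :
    ∃ p : ℝ → ℝ, LipschitzWith 1 p ∧ p 0 = 0 ∧ ∀ a, p (sol.t a) = sol.x a := by
  have hx := hf.abs_x_le htau
  obtain ⟨p, hp, hpx⟩ := exists_lipschitz_path
    (fun o : Option (Fin n) => o.elim 0 sol.t) (fun o => o.elim 0 sol.x) (by
      rintro (_ | a) (_ | b)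
      · simp
      · simpa using (hx b).trans (le_abs_self _)
      · simpa using (hx a).trans (le_abs_self _)
      · exact hf.abs_x_sub_le htau a b)
  exact ⟨p, hp, hpx none, fun a => hpx (some a)⟩

/-- Meeting the clients along a 1-Lipschitz path starting in the origin, in the order of their
rendezvous times, is feasible. -/
theorem exists_feasible_of_path {I : CInstance n} (htau : ∀ a, I.tau a = 0)
    (hrel : ∀ a, I.r a = 0) {p : ℝ → ℝ} (hp : LipschitzWith 1 p) (hp0 : p 0 = 0) (t : Fin n → ℝ)
    (hclient : ∀ a, |p (t a) - I.s a| / I.v ≤ t a) (hd : ∀ a, (t a : EReal) ≤ I.d a) :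
    ∃ sol : CSolution n, sol.t = t ∧ Feasible I sol := by
  have ht (a) : 0 ≤ t a := (div_nonneg (abs_nonneg _) I.hv.le).trans (hclient a)
  have hlip (u w : ℝ) : |p u - p w| ≤ |u - w| := by
    simpa [Real.dist_eq] using hp.dist_le_mul u w
  have hsum (a) : t a + |p (t a)| ≤ ∑ b, (t b + |p (t b)|) :=
    Finset.single_le_sum (f := fun b => t b + |p (t b)|)
      (fun b _ => add_nonneg (ht b) (abs_nonneg _)) (Finset.mem_univ a)
  let sol : CSolution n := ⟨Tuple.sort t, t, fun a => p (t a), ∑ b, (t b + |p (t b)|)⟩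
  refine ⟨sol, rfl, ?_, fun a => by simpa [hrel] using hclient a,
    fun a => ⟨by simpa [hrel] using ht a, hd a⟩⟩
  intro i hi hin
  obtain ⟨i, rfl⟩ := Nat.exists_eq_add_of_le' hi
  rw [comp_eq_time I htau, Nat.add_sub_cancel]
  rcases (Nat.le_of_succ_le_succ hin).lt_or_eq with hlt | rfl
  · rw [pos_succ sol hlt, time_succ sol hlt]
    rcases i with _ | i
    · simpa [sol, hp0, abs_of_nonneg (ht _)] using hlip (t (Tuple.sort t ⟨0, hlt⟩)) 0
    · rw [pos_succ sol (Nat.lt_of_succ_lt hlt), time_succ sol (Nat.lt_of_succ_lt hlt)]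
      have hmono : t (Tuple.sort t ⟨i, Nat.lt_of_succ_lt hlt⟩) ≤ t (Tuple.sort t ⟨i + 1, hlt⟩) :=
        Tuple.monotone_sort t (Fin.mk_le_mk.2 i.le_succ)
      have h := hlip (t (Tuple.sort t ⟨i + 1, hlt⟩))
        (t (Tuple.sort t ⟨i, Nat.lt_of_succ_lt hlt⟩))
      rw [abs_of_nonneg (sub_nonneg.2 hmono)] at h
      change t _ + |p (t _) - p (t _)| ≤ t _
      linarith
  · have hpos : pos sol (i + 1) = 0 := by simp [pos]
    have htime : time sol (i + 1) = ∑ b, (t b + |p (t b)|) := by simp [time, sol]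
    rw [hpos, htime, zero_sub, abs_neg]
    rcases i with _ | i
    · simp
    · rw [pos_succ sol i.lt_succ_self, time_succ sol i.lt_succ_self]
      exact hsum _

/-- On its way to a client on one side of the origin, the server gets within reach of every
client starting closer to the origin on that side strictly earlier. -/
theorem exists_earlier_rendezvous {p : ℝ → ℝ} (hp : Continuous p) (hp0 : p 0 = 0)
    {v s s' T : ℝ} (hT : 0 ≤ T) (hside : (s ≤ 0 ∧ s' ≤ 0) ∨ (0 < s ∧ 0 < s'))
    (hs : |s| < |s'|) (hreach : |p T - s'| ≤ v * T) :
    ∃ u < T, |p u - s| ≤ v * u := by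
  obtain ⟨e, he, hes, hes'⟩ : ∃ e : ℝ, |e| = 1 ∧ e * |s| = s ∧ e * |s'| = s' := by
    rcases hside with ⟨h, h'⟩ | ⟨h, h'⟩
    · exact ⟨-1, by simp, by simp [abs_of_nonpos h], by simp [abs_of_nonpos h']⟩
    · exact ⟨1, by simp, by simp [abs_of_pos h], by simp [abs_of_pos h']⟩
  have hee : e * e = 1 := by rw [← abs_mul_abs_self, he, one_mul]
  have hfactor (u c : ℝ) : |p u - e * c| = |e * p u - c| := by
    rw [← one_mul |p u - e * c|, ← he, ← abs_mul, mul_sub, ← mul_assoc, hee, one_mul]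
  rw [← hes', hfactor] at hreach
  have hgT : |s'| ≤ e * p T + v * T := by linarith [neg_abs_le (e * p T - |s'|)]
  obtain ⟨u, ⟨hu0, huT⟩, hu⟩ := intermediate_value_Icc (f := fun u => e * p u + v * u) hT
    (by fun_prop) (show |s| ∈ Set.Icc _ _ from ⟨by simp [hp0], hs.le.trans hgT⟩)
  have huv : e * p u - |s| = -(v * u) := by linarith
  have hne : u ≠ T := by
    rintro rfl
    linarith
  have hv : 0 ≤ v * u := by
    have hvT : 0 ≤ v * T := (abs_nonneg _).trans hreach
    rcases hu0.eq_or_lt with rfl | hpos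
    · simp
    · exact mul_nonneg (nonneg_of_mul_nonneg_left hvT (hpos.trans_le huT)) hu0
  exact ⟨u, huT.lt_of_ne hne, by rw [← hes, hfactor, huv, abs_neg, abs_of_nonneg hv]⟩

end CLTSP

open CLTSP in
/-- CLTRP with zero processing times and only deadlines: every
optimal solution is order-preserving. -/
theorem cltrp_zeroProc_deadlines_optimal_orderPreserving
    {n : ℕ} (I : CInstance n)
    (htau : ∀ a, I.tau a = 0) (hrel : ∀ a, I.r a = 0)
    (sol : CSolution n) (hopt : OptimalTRP I sol) :
    OrderPreserving I sol := by
  intro a a' hside hs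
  obtain ⟨hf, hmin⟩ := hopt
  by_contra! hle
  have ht (b) : 0 ≤ sol.t b := (abs_nonneg _).trans (hf.abs_x_le htau b)
  have hclient (b) : |sol.x b - I.s b| / I.v ≤ sol.t b := by simpa [hrel] using hf.2.1 b
  obtain ⟨p, hp, hp0, hpx⟩ := hf.exists_path htau
  obtain ⟨u, hu, hreach⟩ := exists_earlier_rendezvous hp.continuous hp0 (v := I.v)
    (ht a') hside hs (by
      rw [hpx, mul_comm]
      exact (div_le_iff₀ I.hv).1 (hclient a'))
  have hua : u < sol.t a := hu.trans_le hle
  obtain ⟨sol', hsol', hf'⟩ := exists_feasible_of_path htau hrel hp hp0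
    (Function.update sol.t a u)
    (by
      intro b
      rcases eq_or_ne b a with rfl | hb
      · rw [Function.update_self, div_le_iff₀ I.hv, mul_comm]
        exact hreach
      · simpa [hb, hpx] using hclient b)
    (by
      intro b
      rcases eq_or_ne b a with rfl | hb
      · rw [Function.update_self]
        exact (EReal.coe_le_coe_iff.2 hua.le).trans (hf.2.2 b).2
      · simpa [hb] using (hf.2.2 b).2)
  refine (hmin sol' hf').not_gt ?_
  simp only [csum, htau, add_zero, hsol']
  refine Finset.sum_lt_sum (fun b _ => ?_) ⟨a, Finset.mem_univ a, by simpa using hua⟩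
  exact update_le_self_iff.2 hua.le b
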